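/- Let S be a countably based, left-soft separative, (2,ω)-divisible Cu-semigroup satisfying (O5), (O6) and (O7), and let x ∈ S. Then the set L_x has a supremum σ(x) in S, and: (1) σ(x) is strongly soft, σ(x) ≤ x, and every strongly soft w ∈ S with w ≤ x satisfies w ≤ σ(x) (i.e. σ(x) is the largest strongly soft element dominated by x); (2) ∞x = ∞σ(x); (3) x = σ(x) if and only if x is strongly soft; (4) x ≤ σ(x)+t for every t ∈ S with x ≤ ∞t. -/

import Mathlib

open Set

/-- The way-below relation: `x ≪ y` if for every increasing sequence with a
supremum dominating `y`, some term of the sequence dominates `x`. -/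
def WayBelow {S : Type*} [Preorder S] (x y : S) : Prop :=
  ∀ z : ℕ → S, Monotone z → ∀ s : S, IsLUB (Set.range z) s → y ≤ s → ∃ m : ℕ, x ≤ z m

/-- A Cu-semigroup: a positively ordered commutative monoid satisfying (O1)-(O4). -/
class CuSemigroup (S : Type*) extends AddCommMonoid S, PartialOrder S where
  zero_le : ∀ x : S, 0 ≤ x
  add_mono : ∀ {a b c d : S}, a ≤ b → c ≤ d → a + c ≤ b + d
  O1 : ∀ z : ℕ → S, Monotone z → ∃ s : S, IsLUB (Set.range z) s
  O2 : ∀ x : S, ∃ z : ℕ → S, (∀ n, WayBelow (z n) (z (n + 1))) ∧ IsLUB (Set.range z) x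
  O3 : ∀ {x' x y' y : S}, WayBelow x' x → WayBelow y' y → WayBelow (x' + y') (x + y)
  O4 : ∀ (x y : ℕ → S), Monotone x → Monotone y → ∀ sx sy : S,
      IsLUB (Set.range x) sx → IsLUB (Set.range y) sy →
      IsLUB (Set.range fun n => x n + y n) (sx + sy)

variable {S : Type*}

lemma CuSemigroup.nsmul_mono [CuSemigroup S] (x : S) : Monotone fun n : ℕ => n • x := by
  intro n m h
  obtain ⟨k, rfl⟩ := Nat.exists_eq_add_of_le h
  show n • x ≤ (n + k) • x
  rw [add_nsmul]
  calc n • x = n • x + 0 := by rw [add_zero]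
    _ ≤ n • x + k • x := CuSemigroup.add_mono le_rfl (CuSemigroup.zero_le _)

/-- `infty x` is the supremum of the increasing sequence `n • x`, i.e. `∞x`. -/
noncomputable def infty [CuSemigroup S] (x : S) : S :=
  (CuSemigroup.O1 (fun n : ℕ => n • x) (CuSemigroup.nsmul_mono x)).choose

lemma infty_isLUB [CuSemigroup S] (x : S) :
    IsLUB (Set.range fun n : ℕ => n • x) (infty x) :=
  (CuSemigroup.O1 (fun n : ℕ => n • x) (CuSemigroup.nsmul_mono x)).choose_spec

/-- An element is strongly soft if every `x' ≪ x` admits `t` with `x' + t ≪ x`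
and `x' ≪ ∞t`. -/
def StronglySoft [CuSemigroup S] (x : S) : Prop :=
  ∀ x' : S, WayBelow x' x → ∃ t : S, WayBelow (x' + t) x ∧ WayBelow x' (infty t)

def SatisfiesO5 (S : Type*) [CuSemigroup S] : Prop :=
  ∀ x' x y' y z : S, WayBelow x' x → WayBelow y' y → x + y ≤ z →
    ∃ c : S, WayBelow y' c ∧ x' + c ≤ z ∧ z ≤ x + c

def SatisfiesO6 (S : Type*) [CuSemigroup S] : Prop :=
  ∀ x' x y z : S, WayBelow x' x → WayBelow x (y + z) →
    ∃ v w : S, v ≤ x ∧ v ≤ y ∧ w ≤ x ∧ w ≤ z ∧ x' ≤ v + w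

def SatisfiesO7 (S : Type*) [CuSemigroup S] : Prop :=
  ∀ x' x y' y w : S, WayBelow x' x → x ≤ w → WayBelow y' y → y ≤ w →
    ∃ z : S, WayBelow x' z ∧ WayBelow y' z ∧ z ≤ w ∧ z ≤ x + y

def TwoOmegaDivisible (S : Type*) [CuSemigroup S] : Prop :=
  ∀ x' x : S, WayBelow x' x → ∃ y : S, 2 • y ≤ x ∧ x' ≤ infty y

def WeaklyCancellative (S : Type*) [CuSemigroup S] : Prop :=
  ∀ x y z : S, WayBelow (x + z) (y + z) → WayBelow x y

def Separative (S : Type*) [CuSemigroup S] : Prop :=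
  ∀ x y t : S, WayBelow (x + t) (y + t) → WayBelow t (infty x) → WayBelow t (infty y) →
    WayBelow x y

def LeftSoftSeparative (S : Type*) [CuSemigroup S] : Prop :=
  ∀ x y t : S, StronglySoft x → WayBelow (x + t) (y + t) → WayBelow t (infty x) →
    WayBelow t (infty y) → WayBelow x y

def AlmostUnperforated (S : Type*) [CuSemigroup S] : Prop :=
  ∀ x y : S, (∃ n : ℕ, 1 ≤ n ∧ (n + 1) • x ≤ n • y) → x ≤ y

def CountablyBased (S : Type*) [CuSemigroup S] : Prop :=
  ∃ D : Set S, D.Countable ∧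
    ∀ x : S, ∃ z : ℕ → S, Monotone z ∧ (∀ n, z n ∈ D) ∧ IsLUB (Set.range z) x

/-- `Lset x` is the set `L_x = { u' : u' ≪ u ≪ x for some strongly soft u }`. -/
def Lset [CuSemigroup S] (x : S) : Set S :=
  { u' | ∃ u : S, StronglySoft u ∧ WayBelow u' u ∧ WayBelow u x }

/-- A functional on a Cu-semigroup: a monoid morphism to `[0,∞]` preserving order
and suprema of increasing sequences. -/
structure CuFunctional (S : Type*) [CuSemigroup S] where
  toFun : S → ENNReal
  map_zero : toFun 0 = 0
  map_add : ∀ x y : S, toFun (x + y) = toFun x + toFun y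
  mono : ∀ x y : S, x ≤ y → toFun x ≤ toFun y
  map_sup : ∀ z : ℕ → S, Monotone z → ∀ s : S, IsLUB (Set.range z) s →
    toFun s = ⨆ n, toFun (z n)

/-- Predicate version: `f : S → [0,∞]` is a functional on `S`. -/
def IsCuFunctional [CuSemigroup S] (f : S → ENNReal) : Prop :=
  f 0 = 0 ∧ (∀ x y : S, f (x + y) = f x + f y) ∧ (∀ x y : S, x ≤ y → f x ≤ f y) ∧
  (∀ z : ℕ → S, Monotone z → ∀ s : S, IsLUB (Set.range z) s → f s = ⨆ n, f (z n))

/-- Least upper bound of `A` computed within the subset `T`. -/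
def IsLUBIn [CuSemigroup S] (T : Set S) (A : Set S) (s : S) : Prop :=
  s ∈ T ∧ s ∈ upperBounds A ∧ ∀ b ∈ T, b ∈ upperBounds A → s ≤ b

/-- The way-below relation computed within the subset `T`. -/
def WayBelowIn [CuSemigroup S] (T : Set S) (x y : S) : Prop :=
  ∀ z : ℕ → S, Monotone z → (∀ n, z n ∈ T) → ∀ s : S, IsLUBIn T (Set.range z) s → y ≤ s →
    ∃ m : ℕ, x ≤ z m

/-- `T` is a sub-Cu-semigroup of `S`: a submonoid which is itself a Cu-semigroup
for the inherited order, such that the inclusion preserves suprema of increasing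
sequences and the way-below relation. -/
structure IsSubCuSemigroup [CuSemigroup S] (T : Set S) : Prop where
  zero_mem : (0 : S) ∈ T
  add_mem : ∀ {x y : S}, x ∈ T → y ∈ T → x + y ∈ T
  o1 : ∀ z : ℕ → S, Monotone z → (∀ n, z n ∈ T) → ∃ s : S, IsLUBIn T (Set.range z) s
  o2 : ∀ x ∈ T, ∃ z : ℕ → S, (∀ n, z n ∈ T) ∧ (∀ n, WayBelowIn T (z n) (z (n + 1))) ∧
        IsLUBIn T (Set.range z) x
  o3 : ∀ {x' x y' y : S}, x' ∈ T → x ∈ T → y' ∈ T → y ∈ T →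
        WayBelowIn T x' x → WayBelowIn T y' y → WayBelowIn T (x' + y') (x + y)
  o4 : ∀ (x y : ℕ → S), Monotone x → Monotone y → (∀ n, x n ∈ T) → (∀ n, y n ∈ T) →
        ∀ sx sy : S, IsLUBIn T (Set.range x) sx → IsLUBIn T (Set.range y) sy →
        IsLUBIn T (Set.range fun n => x n + y n) (sx + sy)
  incl_sup : ∀ z : ℕ → S, Monotone z → (∀ n, z n ∈ T) → ∀ s : S,
        IsLUBIn T (Set.range z) s → IsLUB (Set.range z) s
  incl_wayBelow : ∀ {x y : S}, x ∈ T → y ∈ T → WayBelowIn T x y → WayBelow x y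

def SatisfiesO5In [CuSemigroup S] (T : Set S) : Prop :=
  ∀ x' x y' y z : S, x' ∈ T → x ∈ T → y' ∈ T → y ∈ T → z ∈ T →
    WayBelowIn T x' x → WayBelowIn T y' y → x + y ≤ z →
    ∃ c ∈ T, WayBelowIn T y' c ∧ x' + c ≤ z ∧ z ≤ x + c

def SatisfiesO6In [CuSemigroup S] (T : Set S) : Prop :=
  ∀ x' x y z : S, x' ∈ T → x ∈ T → y ∈ T → z ∈ T →
    WayBelowIn T x' x → WayBelowIn T x (y + z) →
    ∃ v ∈ T, ∃ w ∈ T, v ≤ x ∧ v ≤ y ∧ w ≤ x ∧ w ≤ z ∧ x' ≤ v + w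

def SatisfiesO7In [CuSemigroup S] (T : Set S) : Prop :=
  ∀ x' x y' y w : S, x' ∈ T → x ∈ T → y' ∈ T → y ∈ T → w ∈ T →
    WayBelowIn T x' x → x ≤ w → WayBelowIn T y' y → y ≤ w →
    ∃ z ∈ T, WayBelowIn T x' z ∧ WayBelowIn T y' z ∧ z ≤ w ∧ z ≤ x + y

/-- `f` is a functional on the sub-Cu-semigroup `T` (values off `T` are irrelevant). -/
def IsFunctionalOn [CuSemigroup S] (T : Set S) (f : S → ENNReal) : Prop :=
  f 0 = 0 ∧
  (∀ x ∈ T, ∀ y ∈ T, f (x + y) = f x + f y) ∧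
  (∀ x ∈ T, ∀ y ∈ T, x ≤ y → f x ≤ f y) ∧
  (∀ z : ℕ → S, Monotone z → (∀ n, z n ∈ T) → ∀ s : S, IsLUBIn T (Set.range z) s →
    f s = ⨆ n, f (z n))

/-- An element is full if `x ≤ ∞e` for every `x`. -/
def IsFull [CuSemigroup S] (e : S) : Prop := ∀ x : S, x ≤ infty e

/-- Condition (R1) for `r`: comparison of `x` with `y` whenever
`λ(x) + r·λ(e) ≤ λ(y)` for all functionals. -/
def SatisfiesR1 (S : Type*) [CuSemigroup S] (e : S) (r : NNReal) : Prop :=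
  ∀ x y : S,
    (∀ lam : CuFunctional S, lam.toFun x + (r : ENNReal) * lam.toFun e ≤ lam.toFun y) → x ≤ y

/-- The radius of comparison of `(S, e)`. -/
noncomputable def rc (S : Type*) [CuSemigroup S] (e : S) : ENNReal :=
  ⨅ r ∈ {r : NNReal | 0 < r ∧ SatisfiesR1 S e r}, (r : ENNReal)

/-- Condition (R1) for the sub-Cu-semigroup `T`. -/
def SatisfiesR1On [CuSemigroup S] (T : Set S) (e : S) (r : NNReal) : Prop :=
  ∀ x ∈ T, ∀ y ∈ T,
    (∀ f : S → ENNReal, IsFunctionalOn T f → f x + (r : ENNReal) * f e ≤ f y) → x ≤ y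

/-- The radius of comparison of `(T, e)` for a sub-Cu-semigroup `T ⊆ S`. -/
noncomputable def rcOn [CuSemigroup S] (T : Set S) (e : S) : ENNReal :=
  ⨅ r ∈ {r : NNReal | 0 < r ∧ SatisfiesR1On T e r}, (r : ENNReal)

/-- `dim S ≤ n` in the sense of covering dimension of Cu-semigroups. -/
def DimLe (S : Type*) [CuSemigroup S] (n : ℕ) : Prop :=
  ∀ (x' x : S) (r : ℕ) (y : Fin r → S), WayBelow x' x → WayBelow x (∑ j, y j) →
    ∃ z : Fin r → Fin (n + 1) → S,
      (∀ j k, WayBelow (z j k) (y j)) ∧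
      WayBelow x' (∑ j, ∑ k, z j k) ∧
      (∀ k, WayBelow (∑ j, z j k) x)

/-- The covering dimension of a Cu-semigroup, in `ℕ ∪ {∞}`. -/
noncomputable def cuDim (S : Type*) [CuSemigroup S] : ℕ∞ :=
  ⨅ n ∈ {n : ℕ | DimLe S n}, (n : ℕ∞)

/-- `dim T ≤ n` for a sub-Cu-semigroup `T ⊆ S`. -/
def DimLeOn [CuSemigroup S] (T : Set S) (n : ℕ) : Prop :=
  ∀ (x' x : S), x' ∈ T → x ∈ T → ∀ (r : ℕ) (y : Fin r → S), (∀ j, y j ∈ T) →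
    WayBelowIn T x' x → WayBelowIn T x (∑ j, y j) →
    ∃ z : Fin r → Fin (n + 1) → S,
      (∀ j k, z j k ∈ T) ∧
      (∀ j k, WayBelowIn T (z j k) (y j)) ∧
      WayBelowIn T x' (∑ j, ∑ k, z j k) ∧
      (∀ k, WayBelowIn T (∑ j, z j k) x)

/-- The covering dimension of a sub-Cu-semigroup `T ⊆ S`. -/
noncomputable def cuDimOn [CuSemigroup S] (T : Set S) : ℕ∞ :=
  ⨅ n ∈ {n : ℕ | DimLeOn T n}, (n : ℕ∞)

namespace WayBelow

section Preorder

variable {P : Type*} [Preorder P] {a b c : P}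

lemma le (h : WayBelow a b) : a ≤ b := by
  obtain ⟨_, hm⟩ := h (fun _ => b) monotone_const b (by simp) le_rfl
  exact hm

lemma trans_le (h : WayBelow a b) (hbc : b ≤ c) : WayBelow a c :=
  fun z hz s hs hc => h z hz s hs (hbc.trans hc)

lemma of_le (hab : a ≤ b) (h : WayBelow b c) : WayBelow a c := fun z hz s hs hc =>
  let ⟨m, hm⟩ := h z hz s hs hc
  ⟨m, hab.trans hm⟩

end Preorder

end WayBelow

namespace CuSemigroup

variable [CuSemigroup S] {a b c p x y z : S}

lemma zero_wayBelow (x : S) : WayBelow 0 x := fun _ _ _ _ _ => ⟨0, zero_le _⟩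

lemma le_add_right (a b : S) : a ≤ a + b := by
  simpa using add_mono (le_refl a) (zero_le b)

lemma le_add_left (a b : S) : a ≤ b + a := by
  simpa using add_mono (zero_le b) (le_refl a)

/-- A `≪`-increasing sequence approximating `x` is monotone and consists of elements
way below `x`. -/
lemma exists_approximation (x : S) :
    ∃ z : ℕ → S, Monotone z ∧ (∀ n, WayBelow (z n) x) ∧ IsLUB (Set.range z) x := by
  obtain ⟨z, hz, hx⟩ := O2 x
  exact ⟨z, monotone_nat_of_le_succ fun n => (hz n).le,
    fun n => (hz n).trans_le (hx.1 ⟨n + 1, rfl⟩), hx⟩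

lemma le_of_forall_wayBelow (h : ∀ x', WayBelow x' x → x' ≤ y) : x ≤ y := by
  obtain ⟨z, -, hz, hx⟩ := exists_approximation x
  exact hx.2 (by rintro _ ⟨n, rfl⟩; exact h _ (hz n))

/-- Two elements way below `c` admit a common interpolant. -/
lemma exists_between₂ (ha : WayBelow a c) (hb : WayBelow b c) :
    ∃ m, WayBelow a m ∧ WayBelow b m ∧ WayBelow m c := by
  obtain ⟨z, hz, hc⟩ := O2 c
  have hmono : Monotone z := monotone_nat_of_le_succ fun n => (hz n).le
  obtain ⟨i, hi⟩ := ha z hmono c hc le_rfl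
  obtain ⟨j, hj⟩ := hb z hmono c hc le_rfl
  have key : ∀ {d k}, d ≤ z k → k ≤ max i j → WayBelow d (z (max i j + 1)) :=
    fun h hk => .of_le (h.trans (hmono hk)) (hz _)
  exact ⟨z (max i j + 1), key hi (le_max_left _ _), key hj (le_max_right _ _),
    (hz _).trans_le (hc.1 ⟨_, rfl⟩)⟩

lemma exists_between (h : WayBelow a c) : ∃ m, WayBelow a m ∧ WayBelow m c :=
  let ⟨m, h₁, _, h₂⟩ := exists_between₂ h h
  ⟨m, h₁, h₂⟩

lemma exists_wayBelow_add (h : WayBelow p (a + b)) :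
    ∃ a' b', WayBelow a' a ∧ WayBelow b' b ∧ WayBelow p (a' + b') := by
  obtain ⟨q, hpq, hq⟩ := exists_between h
  obtain ⟨u, hu, hua, hau⟩ := exists_approximation a
  obtain ⟨v, hv, hvb, hbv⟩ := exists_approximation b
  obtain ⟨n, hn⟩ := hq _ (fun i j hij => add_mono (hu hij) (hv hij)) _
    (O4 u v hu hv a b hau hbv) le_rfl
  exact ⟨u n, v n, hua n, hvb n, hpq.trans_le hn⟩

lemma nsmul_le_infty (n : ℕ) (a : S) : n • a ≤ infty a := (infty_isLUB a).1 ⟨n, rfl⟩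

lemma le_infty (a : S) : a ≤ infty a := by simpa using nsmul_le_infty 1 a

lemma add_le_infty (ha : a ≤ infty c) (hb : b ≤ infty c) : a + b ≤ infty c := by
  refine (add_mono ha hb).trans ?_
  refine (O4 _ _ (nsmul_mono c) (nsmul_mono c) _ _ (infty_isLUB c) (infty_isLUB c)).2 ?_
  rintro _ ⟨n, rfl⟩
  simpa [add_nsmul] using nsmul_le_infty (n + n) c

lemma infty_le (h : a ≤ infty b) : infty a ≤ infty b := by
  refine (infty_isLUB a).2 ?_
  rintro _ ⟨n, rfl⟩
  induction n with
  | zero => simpa using zero_le (infty b)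
  | succ n ih => simpa [succ_nsmul] using add_le_infty ih h

lemma infty_mono (h : a ≤ b) : infty a ≤ infty b := infty_le (h.trans (le_infty b))

lemma nsmul_le_nsmul (n : ℕ) (h : a ≤ b) : n • a ≤ n • b := by
  induction n with
  | zero => simp
  | succ n ih => simpa [succ_nsmul] using add_mono ih h

lemma exists_wayBelow_nsmul (n : ℕ) (h : WayBelow p (n • a)) :
    ∃ a', WayBelow a' a ∧ WayBelow p (n • a') := by
  induction n generalizing p with
  | zero => exact ⟨0, zero_wayBelow a, by simpa using h⟩
  | succ n ih =>
    obtain ⟨b, c, hb, hc, hp⟩ := exists_wayBelow_add (by simpa [succ_nsmul] using h)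
    obtain ⟨d, hd, hbd⟩ := ih hb
    obtain ⟨m, hdm, hcm, hm⟩ := exists_between₂ hd hc
    refine ⟨m, hm, hp.trans_le ?_⟩
    rw [succ_nsmul]
    exact add_mono (hbd.le.trans (nsmul_le_nsmul n hdm.le)) hcm.le

lemma exists_wayBelow_infty (h : WayBelow p (infty a)) :
    ∃ a', WayBelow a' a ∧ WayBelow p (infty a') := by
  obtain ⟨q, hpq, hq⟩ := exists_between h
  obtain ⟨n, hn⟩ := hq _ (nsmul_mono a) _ (infty_isLUB a) le_rfl
  obtain ⟨a', ha', hp⟩ := exists_wayBelow_nsmul n (hpq.trans_le hn)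
  exact ⟨a', ha', hp.trans_le (nsmul_le_infty n a')⟩

/-- Strong softness may be tested with `≤` in place of `≪`. -/
lemma stronglySoft_of_le
    (h : ∀ x', WayBelow x' x → ∃ t, x' + t ≤ x ∧ x' ≤ infty t) : StronglySoft x := by
  intro x' hx'
  obtain ⟨m, hm, hmx⟩ := exists_between hx'
  obtain ⟨t, ht, hmt⟩ := h m hmx
  obtain ⟨t', ht', hxt⟩ := exists_wayBelow_infty (hm.trans_le hmt)
  exact ⟨t', (O3 hm ht').trans_le ht, hxt⟩

lemma _root_.StronglySoft.add_of_le_infty (hz : StronglySoft z) (h : a ≤ infty z) :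
    StronglySoft (a + z) := by
  refine stronglySoft_of_le fun p hp => ?_
  obtain ⟨a', z', ha', hz', hpa⟩ := exists_wayBelow_add hp
  obtain ⟨q, hq, haq⟩ := exists_wayBelow_infty (ha'.trans_le h)
  obtain ⟨m, hzm, hqm, hm⟩ := exists_between₂ hz' hq
  obtain ⟨t, ht, hmt⟩ := hz m hm
  have hat : a' ≤ infty t := haq.le.trans (infty_le (hqm.le.trans hmt.le))
  refine ⟨t, ?_, hpa.le.trans (add_le_infty hat (hzm.le.trans hmt.le))⟩
  calc p + t ≤ a' + m + t := add_mono (hpa.le.trans (add_mono le_rfl hzm.le)) le_rfl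
    _ = a' + (m + t) := add_assoc _ _ _
    _ ≤ a + z := add_mono ha'.le ht.le

/-- Given `z ≪ y`, one splits off a piece of `y` that generates `z` as an ideal, leaving
enough room to repeat. -/
lemma exists_split (hdiv : TwoOmegaDivisible S) (h : WayBelow z y) :
    ∃ z' y', WayBelow z' y' ∧ z' + y' ≤ y ∧ z ≤ infty z' := by
  obtain ⟨m, hzm, hm⟩ := exists_between h
  obtain ⟨w, hw, hmw⟩ := hdiv m y hm
  obtain ⟨z', hz', hz⟩ := exists_wayBelow_infty (hzm.trans_le hmw)
  refine ⟨z', w, hz', (add_mono hz'.le le_rfl).trans ?_, hz.le⟩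
  rwa [← two_nsmul]

/-- Abundance of strongly soft elements. -/
lemma exists_stronglySoft_le (hdiv : TwoOmegaDivisible S) (h : WayBelow p x) :
    ∃ e, StronglySoft e ∧ e ≤ x ∧ p ≤ infty e := by
  choose! f g hfg hadd hinf using
    fun (q : S × S) (hq : WayBelow q.1 q.2) => exists_split hdiv hq
  let st : ℕ → S × S := fun n => Nat.rec (p, x) (fun _ q => (f q, g q)) n
  have hst : ∀ n, WayBelow (st n).1 (st n).2 := by
    intro n
    induction n with
    | zero => exact h
    | succ n ih => exact hfg _ ih
  let s : ℕ → S := fun n => ∑ i ∈ Finset.range n, (st (i + 1)).1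
  have hs : ∀ n, s (n + 1) = s n + (st (n + 1)).1 := fun n => Finset.sum_range_succ _ n
  have hmono : Monotone s := monotone_nat_of_le_succ fun n => by
    rw [hs]; exact le_add_right _ _
  have hroom : ∀ n, s n + (st n).2 ≤ x := by
    intro n
    induction n with
    | zero => simp [s, st]
    | succ n ih =>
      rw [hs, add_assoc]
      exact (add_mono le_rfl (hadd _ (hst n))).trans ih
  have hgen : ∀ n, s n ≤ infty (st n).1 := by
    intro n
    induction n with
    | zero => simpa [s] using zero_le _
    | succ n ih =>
      rw [hs]
      exact add_le_infty (ih.trans (infty_le (hinf _ (hst n)))) (le_infty _)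
  obtain ⟨e, he⟩ := O1 s hmono
  refine ⟨e, stronglySoft_of_le fun q hq => ?_, he.2 ?_, ?_⟩
  · obtain ⟨n, hn⟩ := hq s hmono e he le_rfl
    refine ⟨(st (n + 1)).1, ?_, hn.trans ((hgen n).trans (infty_le (hinf _ (hst n))))⟩
    exact (add_mono hn le_rfl).trans ((hs n).symm.le.trans (he.1 ⟨n + 1, rfl⟩))
  · rintro _ ⟨n, rfl⟩
    exact (le_add_right _ _).trans (hroom n)
  · refine (hinf _ (hst 0)).trans (infty_mono ?_)
    refine le_trans ?_ (he.1 ⟨1, rfl⟩)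
    simp [s, st]

lemma exists_stronglySoft_of_wayBelow_infty (hdiv : TwoOmegaDivisible S)
    (h : WayBelow p (infty x)) : ∃ e, StronglySoft e ∧ e ≤ x ∧ p ≤ infty e := by
  obtain ⟨x', hx', hp⟩ := exists_wayBelow_infty h
  obtain ⟨e, he, hex, hxe⟩ := exists_stronglySoft_le hdiv hx'
  exact ⟨e, he, hex, hp.le.trans (infty_le hxe)⟩

/-- Strongly soft elements interpolate below strongly soft elements. -/
lemma _root_.StronglySoft.exists_between (hdiv : TwoOmegaDivisible S) (hx : StronglySoft x)
    (h : WayBelow a x) : ∃ u, StronglySoft u ∧ WayBelow a u ∧ WayBelow u x := by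
  obtain ⟨m, ham, hm⟩ := CuSemigroup.exists_between h
  obtain ⟨t, ht, hmt⟩ := hx m hm
  obtain ⟨e, he, het, hme⟩ := exists_stronglySoft_of_wayBelow_infty hdiv hmt
  exact ⟨m + e, he.add_of_le_infty hme, ham.trans_le (le_add_right _ _),
    .of_le (add_mono le_rfl het) ht⟩

/-- An element way below a strongly soft element `u ≤ x` has a full complement in `x`. -/
lemma _root_.StronglySoft.exists_full_complement (hO5 : SatisfiesO5 S) {u : S}
    (hu : StronglySoft u) (hux : u ≤ x) (h : WayBelow a u) :
    ∃ c, a + c ≤ x ∧ x ≤ infty c := by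
  obtain ⟨m, ham, hm⟩ := exists_between h
  obtain ⟨t, ht, hmt⟩ := hu m hm
  obtain ⟨t', ht', hmt'⟩ := exists_wayBelow_infty hmt
  obtain ⟨c, hc, hac, hxc⟩ := hO5 a m t' t x ham ht' (ht.le.trans hux)
  exact ⟨c, hac, hxc.trans
    (add_le_infty (hmt'.le.trans (infty_mono hc.le)) (le_infty c))⟩

/-- A strongly soft element below `x` can be enlarged to one that is almost full in `x`. -/
lemma _root_.StronglySoft.exists_enlarge (hdiv : TwoOmegaDivisible S) (hO5 : SatisfiesO5 S)
    {u : S} (hu : StronglySoft u) (hux : u ≤ x) (h : WayBelow a u)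
    (hp : WayBelow p (infty x)) :
    ∃ w, StronglySoft w ∧ w ≤ x ∧ WayBelow a w ∧ WayBelow p (infty w) := by
  obtain ⟨m, ham, hm⟩ := exists_between h
  obtain ⟨c, hmc, hxc⟩ := hu.exists_full_complement hO5 hux hm
  obtain ⟨q, hmq, hpq, hq⟩ := exists_between₂
    ((hm.trans_le hux).trans_le hxc) (hp.trans_le (infty_le hxc))
  obtain ⟨e, he, hec, hqe⟩ := exists_stronglySoft_of_wayBelow_infty hdiv hq
  exact ⟨m + e, he.add_of_le_infty (hmq.le.trans hqe), (add_mono le_rfl hec).trans hmc,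
    ham.trans_le (le_add_right _ _),
    (hpq.trans_le hqe).trans_le (infty_mono (le_add_left _ _))⟩

lemma exists_two_pow_nsmul_le (hdiv : TwoOmegaDivisible S) (k : ℕ) (h : WayBelow p x) :
    ∃ y, 2 ^ k • y ≤ x ∧ p ≤ infty y := by
  induction k generalizing p with
  | zero => exact ⟨x, by simp, h.le.trans (le_infty x)⟩
  | succ k ih =>
    obtain ⟨m, hpm, hm⟩ := exists_between h
    obtain ⟨y, hy, hmy⟩ := ih hm
    obtain ⟨y', hy', hp⟩ := exists_wayBelow_infty (hpm.trans_le hmy)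
    obtain ⟨z, hz, hyz⟩ := hdiv y' y hy'
    refine ⟨z, ?_, hp.le.trans (infty_le hyz)⟩
    rw [pow_succ, mul_nsmul']
    exact (nsmul_le_nsmul _ hz).trans hy

lemma exists_nsmul_le (hdiv : TwoOmegaDivisible S) (n : ℕ) (h : WayBelow p x) :
    ∃ y, n • y ≤ x ∧ p ≤ infty y := by
  obtain ⟨y, hy, hp⟩ := exists_two_pow_nsmul_le hdiv n h
  exact ⟨y, (nsmul_mono y n.lt_two_pow_self.le).trans hy, hp⟩

/-- If `x ≤ n • t`, then elements way below `x` lie in the ideal generated by an element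
below both `t` and `n • x`. -/
lemma exists_le_le_nsmul (hO6 : SatisfiesO6 S) (hO7 : SatisfiesO7 S) {t : S} (n : ℕ)
    (h : WayBelow p x) (hx : x ≤ n • t) : ∃ z, z ≤ t ∧ z ≤ n • x ∧ p ≤ infty z := by
  induction n generalizing p x with
  | zero =>
    refine ⟨0, zero_le _, by simp, (h.le.trans hx).trans ?_⟩
    simpa using zero_le _
  | succ n ih =>
    obtain ⟨r, hpr, hr⟩ := exists_between h
    obtain ⟨q, hrq, hq⟩ := exists_between hr
    rw [succ_nsmul] at hx
    obtain ⟨v, w, hvq, hvt, hwq, hwt, hrvw⟩ := hO6 r q (n • t) t hrq (hq.trans_le hx)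
    obtain ⟨v', w₀, hv', hw₀, hp⟩ := exists_wayBelow_add (hpr.trans_le hrvw)
    obtain ⟨z₁, hz₁t, hz₁v, hvz₁⟩ := ih hv' hvt
    have hp' : WayBelow p (infty (z₁ + w)) := hp.trans_le <| add_le_infty
      (hvz₁.trans (infty_mono (le_add_right _ _)))
      ((hw₀.le.trans (le_add_left w z₁)).trans (le_infty _))
    obtain ⟨g, hg, hpg⟩ := exists_wayBelow_infty hp'
    obtain ⟨z₁', w', hz₁', hw', hg'⟩ := exists_wayBelow_add hg
    obtain ⟨z, hz₁z, hwz, hzt, hz⟩ := hO7 z₁' z₁ w' w t hz₁' hz₁t hw' hwt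
    refine ⟨z, hzt, ?_, hpg.le.trans (infty_le (hg'.le.trans ?_))⟩
    · rw [succ_nsmul]
      exact hz.trans (add_mono (hz₁v.trans (nsmul_le_nsmul n (hvq.trans hq.le)))
        (hwq.trans hq.le))
    · exact add_le_infty (hz₁z.le.trans (le_infty z)) (hwz.le.trans (le_infty z))

/-- If `x ≤ ∞t`, then elements way below `x` lie in the ideal generated by a common lower
bound of `x` and `t`. -/
lemma exists_le_le_of_le_infty (hdiv : TwoOmegaDivisible S) (hO6 : SatisfiesO6 S)
    (hO7 : SatisfiesO7 S) {t : S} (h : WayBelow p x) (hx : x ≤ infty t) :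
    ∃ z, z ≤ x ∧ z ≤ t ∧ p ≤ infty z := by
  obtain ⟨q, hpq, hq⟩ := exists_between h
  obtain ⟨r, hqr, hr⟩ := exists_between hq
  obtain ⟨n, hn⟩ := hr _ (nsmul_mono t) _ (infty_isLUB t) hx
  obtain ⟨y, hyr, hqy⟩ := exists_nsmul_le hdiv (n + 1) hqr
  obtain ⟨y', hy', hpy⟩ := exists_wayBelow_infty (hpq.trans_le hqy)
  have hyr' : y ≤ r := by
    refine le_trans ?_ hyr
    rw [succ_nsmul]
    exact le_add_left _ _
  obtain ⟨z, hzt, hzy, hyz⟩ := exists_le_le_nsmul hO6 hO7 n hy' (hyr'.trans hn)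
  refine ⟨z, (hzy.trans ?_).trans hr.le, hzt, hpy.le.trans (infty_le hyz)⟩
  exact (nsmul_mono y n.le_succ).trans hyr

/-- The strongly soft elements below `x` are directed up to way-below approximation. -/
lemma exists_stronglySoft_directed (hsep : LeftSoftSeparative S) (hdiv : TwoOmegaDivisible S)
    (hO5 : SatisfiesO5 S) (hO6 : SatisfiesO6 S) (hO7 : SatisfiesO7 S) {u' u v' v : S}
    (hu : StronglySoft u) (hux : u ≤ x) (hu' : WayBelow u' u)
    (hv : StronglySoft v) (hvx : v ≤ x) (hv' : WayBelow v' v) :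
    ∃ w, StronglySoft w ∧ w ≤ x ∧ WayBelow u' w ∧ WayBelow v' w := by
  obtain ⟨a₁, hua₁, ha₁⟩ := exists_between hu'
  obtain ⟨a₂, ha₁₂, ha₂⟩ := exists_between ha₁
  obtain ⟨a₃, ha₂₃, ha₃⟩ := exists_between ha₂
  obtain ⟨b₁, hvb₁, hb₁⟩ := exists_between hv'
  obtain ⟨b₂, hb₁₂, hb₂⟩ := exists_between hb₁
  obtain ⟨b₃, hb₂₃, hb₃⟩ := exists_between hb₂
  have h₃ : WayBelow (a₃ + b₃) (infty x) := (O3 ha₃ hb₃).trans_le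
    (add_le_infty (hux.trans (le_infty x)) (hvx.trans (le_infty x)))
  -- Almost full strongly soft `A` with room `A + t₀ ≪ x`, for each of the two elements.
  have room : ∀ {d e : S}, StronglySoft e → e ≤ x → WayBelow d e →
      ∃ A A₂ t t₀, StronglySoft A ∧ WayBelow d A ∧ WayBelow (a₃ + b₃) (infty A) ∧
        WayBelow A A₂ ∧ WayBelow t₀ t ∧ A₂ + t ≤ x ∧ a₃ + b₃ ≤ infty t₀ := by
    intro d e he hex hd
    obtain ⟨U, hU, hUx, hdU, hU₃⟩ := he.exists_enlarge hdiv hO5 hex hd h₃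
    obtain ⟨A₁, hA₁, h₃A₁⟩ := exists_wayBelow_infty hU₃
    obtain ⟨m, hdm, hA₁m, hm⟩ := exists_between₂ hdU hA₁
    obtain ⟨A, hA, hmA, hAU⟩ := hU.exists_between hdiv hm
    obtain ⟨A₂, hAA₂, hA₂⟩ := exists_between hAU
    obtain ⟨t, ht, hxt⟩ := hU.exists_full_complement hO5 hUx hA₂
    obtain ⟨t₀, ht₀, h₃t₀⟩ := exists_wayBelow_infty (h₃.trans_le (infty_le hxt))
    exact ⟨A, A₂, t, t₀, hA, hdm.trans_le hmA.le,
      h₃A₁.trans_le (infty_mono (hA₁m.le.trans hmA.le)), hAA₂, ht₀, ht, h₃t₀.le⟩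
  obtain ⟨A, A₂, t, t₀, -, haA, h₃A, hAA₂, ht₀, hAx, h₃t₀⟩ := room hu hux ha₃
  obtain ⟨B, B₂, q, q₀, hB, hbB, h₃B, hBB₂, hq₀, hBx, h₃q₀⟩ := room hv hvx hb₃
  -- A common lower bound `y` of `t₀`, `q₀` and `a₃ + b₃` generating `a₁ + b₁`.
  obtain ⟨y₁, hy₁₃, hy₁t, h₂y₁⟩ := exists_le_le_of_le_infty hdiv hO6 hO7
    (O3 ha₂₃ hb₂₃) h₃t₀
  obtain ⟨y₁', hy₁', h₁y₁'⟩ := exists_wayBelow_infty ((O3 ha₁₂ hb₁₂).trans_le h₂y₁)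
  obtain ⟨y, hyy₁, hyq, hy₁'y⟩ := exists_le_le_of_le_infty hdiv hO6 hO7 hy₁'
    (hy₁₃.trans h₃q₀)
  have hyt : y ≤ t₀ := hyy₁.trans hy₁t
  have hy₃ : y ≤ a₃ + b₃ := hyy₁.trans hy₁₃
  obtain ⟨y', hy', h₁y'⟩ := exists_wayBelow_infty (h₁y₁'.trans_le (infty_le hy₁'y))
  obtain ⟨c, hAc, hcx, hxc⟩ := hO5 y' y A A₂ x hy' hAA₂ <| by
    rw [add_comm]
    exact (add_mono le_rfl (hyt.trans ht₀.le)).trans hAx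
  have hBc : WayBelow B c := by
    refine hsep B c y hB ?_ (.of_le hy₃ h₃B) ((WayBelow.of_le hy₃ h₃A).trans_le
      (infty_mono hAc.le))
    refine (WayBelow.of_le (add_mono le_rfl hyq) (O3 hBB₂ hq₀)).trans_le (hBx.trans ?_)
    rwa [add_comm c y]
  -- Cut `c` down to the ideal generated by `y'` and soften.
  obtain ⟨z, huz, hvz, hzc, hz⟩ := hO7 u' a₁ v' b₁ c hua₁
    ((ha₁₂.le.trans ha₂₃.le).trans (haA.le.trans hAc.le)) hvb₁
    ((hb₁₂.le.trans hb₂₃.le).trans (hbB.le.trans hBc.le))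
  obtain ⟨e, he, hey, h₁e⟩ := exists_stronglySoft_of_wayBelow_infty hdiv h₁y'
  refine ⟨z + e, he.add_of_le_infty (hz.trans h₁e), ?_,
    huz.trans_le (le_add_right _ _), hvz.trans_le (le_add_right _ _)⟩
  rw [add_comm]
  exact (add_mono hey hzc).trans hcx

lemma mem_Lset_of_le (hdiv : TwoOmegaDivisible S) {u' u : S} (hu : StronglySoft u)
    (hux : u ≤ x) (h : WayBelow u' u) : u' ∈ Lset x := by
  obtain ⟨w, hw, huw, hwu⟩ := hu.exists_between hdiv h
  exact ⟨w, hw, huw, hwu.trans_le hux⟩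

lemma zero_mem_Lset (x : S) : (0 : S) ∈ Lset x := by
  refine ⟨0, fun x' hx' => ⟨0, ?_, ?_⟩, zero_wayBelow 0, zero_wayBelow x⟩
  · simpa using hx'
  · exact hx'.trans_le (zero_le _)

/-- If `L_x` has a cofinal sequence and is directed, it has a supremum. -/
lemma exists_isLUB_Lset (hcb : CountablyBased S)
    (hdir : ∀ a ∈ Lset x, ∀ b ∈ Lset x, ∃ c ∈ Lset x, a ≤ c ∧ b ≤ c) :
    ∃ (z : ℕ → S) (s : S), Monotone z ∧ (∀ n, z n ∈ Lset x) ∧ IsLUB (Set.range z) s ∧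
      IsLUB (Lset x) s := by
  obtain ⟨D, hD, happ⟩ := hcb
  obtain ⟨f, hf⟩ := ((hD.mono (Set.inter_subset_left (t := Lset x))).insert 0).exists_eq_range
    (Set.insert_nonempty _ _)
  have hfL : ∀ n, f n ∈ Lset x := by
    intro n
    have hn : f n ∈ insert 0 (D ∩ Lset x) := hf ▸ ⟨n, rfl⟩
    rcases hn with hn | hn
    · rw [hn]; exact zero_mem_Lset x
    · exact hn.2
  choose! g hgL hga hgb using hdir
  let z : ℕ → S := fun n => Nat.rec 0 (fun k a => g a (f k)) n
  have hzL : ∀ n, z n ∈ Lset x := by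
    intro n
    induction n with
    | zero => exact zero_mem_Lset x
    | succ n ih => exact hgL _ ih _ (hfL n)
  have hmono : Monotone z := monotone_nat_of_le_succ fun n => hga _ (hzL n) _ (hfL n)
  obtain ⟨s, hs⟩ := O1 z hmono
  refine ⟨z, s, hmono, hzL, hs, ?_, fun b hb => hs.2 ?_⟩
  · rintro a ⟨u, hu, hau, hux⟩
    obtain ⟨m, ham, hm⟩ := exists_between hau
    obtain ⟨d, hd, hdD, hdm⟩ := happ m
    obtain ⟨k, hk⟩ := ham d hd m hdm le_rfl
    have hdk : d k ∈ insert 0 (D ∩ Lset x) :=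
      Or.inr ⟨hdD k, u, hu, .of_le (hdm.1 ⟨k, rfl⟩) hm, hux⟩
    rw [hf] at hdk
    obtain ⟨n, hn⟩ := hdk
    exact (hk.trans hn.symm.le).trans
      ((hgb _ (hzL n) _ (hfL n)).trans (hs.1 ⟨n + 1, rfl⟩))
  · rintro _ ⟨n, rfl⟩
    exact hb (hzL n)

/-- If `x ≤ ∞t`, then elements way below `x` are dominated by `w + t` for some strongly
soft `w ≤ x`. -/
lemma exists_stronglySoft_le_add (hdiv : TwoOmegaDivisible S) (hO5 : SatisfiesO5 S)
    (hO6 : SatisfiesO6 S) (hO7 : SatisfiesO7 S) {t : S} (h : WayBelow p x)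
    (hx : x ≤ infty t) : ∃ w, StronglySoft w ∧ w ≤ x ∧ p ≤ w + t := by
  obtain ⟨q, hpq, hq⟩ := exists_between h
  obtain ⟨r, hqr, hr⟩ := exists_between hq
  obtain ⟨z, hzx, hzt, hrz⟩ := exists_le_le_of_le_infty hdiv hO6 hO7 hr hx
  obtain ⟨z', hz', hqz'⟩ := exists_wayBelow_infty (hqr.trans_le hrz)
  obtain ⟨e, he, hez, hqe⟩ := exists_stronglySoft_of_wayBelow_infty hdiv hqz'
  obtain ⟨c, -, hcx, hxc⟩ := hO5 z' z 0 0 x hz' (zero_wayBelow 0) (by simpa using hzx)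
  obtain ⟨z₁, c₁, -, hz₁, hc₁q, hc₁, hpzc⟩ := hO6 p q z c hpq (hq.trans_le hxc)
  refine ⟨c₁ + e, he.add_of_le_infty (hc₁q.trans hqe), ?_, hpzc.trans ?_⟩
  · rw [add_comm]
    exact (add_mono hez hc₁).trans hcx
  · rw [add_comm]
    exact add_mono (le_add_right _ _) (hz₁.trans hzt)

end CuSemigroup

open CuSemigroup in
/-- In a countably based, left-soft separative, (2,ω)-divisible
Cu-semigroup satisfying (O5)-(O7), `L_x` has a supremum `σ(x)`, which is the
largest strongly soft element below `x`, satisfies `∞x = ∞σ(x)`,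
`x = σ(x) ↔ x` strongly soft, and `x ≤ σ(x) + t` whenever `x ≤ ∞t`. -/
theorem sigma_properties {S : Type*} [CuSemigroup S]
    (hcb : CountablyBased S) (hsep : LeftSoftSeparative S)
    (hdiv : TwoOmegaDivisible S)
    (hO5 : SatisfiesO5 S) (hO6 : SatisfiesO6 S) (hO7 : SatisfiesO7 S)
    (x : S) :
    ∃ s : S, IsLUB (Lset x) s ∧
      StronglySoft s ∧ s ≤ x ∧ (∀ w : S, StronglySoft w → w ≤ x → w ≤ s) ∧
      infty x = infty s ∧
      (x = s ↔ StronglySoft x) ∧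
      (∀ t : S, x ≤ infty t → x ≤ s + t) := by
  obtain ⟨z, s, hz, hzL, hzs, hs⟩ := exists_isLUB_Lset (x := x) hcb <| by
    rintro a ⟨u, hu, hau, hux⟩ b ⟨v, hv, hbv, hvx⟩
    obtain ⟨w, hw, hwx, haw, hbw⟩ := exists_stronglySoft_directed hsep hdiv hO5 hO6 hO7
      hu hux.le hau hv hvx.le hbv
    obtain ⟨m, ham, hbm, hm⟩ := exists_between₂ haw hbw
    exact ⟨m, mem_Lset_of_le hdiv hw hwx hm, ham.le, hbm.le⟩
  have hmax : ∀ w : S, StronglySoft w → w ≤ x → w ≤ s := fun w hw hwx =>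
    le_of_forall_wayBelow fun w' hw' => hs.1 (mem_Lset_of_le hdiv hw hwx hw')
  have hsx : s ≤ x := hs.2 fun a ⟨u, _, hau, hux⟩ => hau.le.trans hux.le
  have hsoft : StronglySoft s := by
    intro a ha
    obtain ⟨n, hn⟩ := ha z hz s hzs le_rfl
    obtain ⟨w, hw, hzw, hwx⟩ := hzL n
    obtain ⟨t, ht, hat⟩ := hw a (.of_le hn hzw)
    exact ⟨t, ht.trans_le (hmax w hw hwx.le), hat⟩
  refine ⟨s, hs, hsoft, hsx, hmax, le_antisymm (infty_le ?_) (infty_mono hsx),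
    ⟨fun h => h ▸ hsoft, fun h => le_antisymm (hmax x h le_rfl) hsx⟩, fun t ht => ?_⟩
  · refine le_of_forall_wayBelow fun a ha => ?_
    obtain ⟨e, he, hex, hae⟩ := exists_stronglySoft_le hdiv ha
    exact hae.trans (infty_mono (hmax e he hex))
  · refine le_of_forall_wayBelow fun a ha => ?_
    obtain ⟨w, hw, hwx, haw⟩ := exists_stronglySoft_le_add hdiv hO5 hO6 hO7 ha ht
    exact haw.trans (add_mono (hmax w hw hwx) le_rfl)
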